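/- arXiv:2512.11406 — 3 statements merged into one kernel-verified Lean document; each statement's English description precedes it below -/
import Mathlib

section
/- Let Θ₀ and Δ be real symmetric P×P matrices such that both Θ₀ and Θ₀ + Δ are positive definite. Then log det(Θ₀ + Δ) = log det(Θ₀) + tr(Θ₀⁻¹ Δ) − vec(Δ)ᵀ [ ∫₀¹ (1 − v) H(Θ₀, Δ, v) dv ] vec(Δ), where H(Θ₀, Δ, v) = ((Θ₀ + vΔ)⁻¹)ᵀ ⊗ (Θ₀ + vΔ)⁻¹ (the integral being the entrywise integral of the P²×P² matrix-valued function, which is well defined since Θ₀ + vΔ is positive definite for all v ∈ [0,1]). -/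
open Matrix Kronecker

/-- `vec` of a square matrix: stacking the columns, so the index pair is
`(column, row)` (outer index the column, inner index the row). -/
def vecOf {P : ℕ} (A : Matrix (Fin P) (Fin P) ℝ) : Fin P × Fin P → ℝ :=
  fun qp => A qp.2 qp.1

section aux

attribute [local instance] Matrix.linftyOpNormedRing Matrix.linftyOpNormedAlgebra

theorem inv_entry_deriv {P : ℕ} (A B : Matrix (Fin P) (Fin P) ℝ) (v : ℝ)
    (h : IsUnit (A + v • B)) (i j : Fin P) :
    HasDerivAt (fun w : ℝ => (A + w • B)⁻¹ i j)
      (-((A + v • B)⁻¹ * B * (A + v • B)⁻¹) i j) v := by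
  obtain ⟨u, hu⟩ := h
  have h1 : HasDerivAt (fun w : ℝ => A + w • B) B v := by
    have h0 := ((hasDerivAt_id v).smul_const B).const_add A
    rw [one_smul] at h0
    exact h0
  have h2 := hasFDerivAt_ringInverse (𝕜 := ℝ) u
  rw [hu] at h2
  have h3 := h2.comp_hasDerivAt v h1
  let L : Matrix (Fin P) (Fin P) ℝ →ₗ[ℝ] ℝ := Matrix.entryLinearMap ℝ ℝ i j
  have h4 := (LinearMap.toContinuousLinearMap L).hasFDerivAt.comp_hasDerivAt v h3
  have h5 : ((u⁻¹ : (Matrix (Fin P) (Fin P) ℝ)ˣ) : Matrix (Fin P) (Fin P) ℝ)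
      = (A + v • B)⁻¹ := by
    rw [← hu, Matrix.coe_units_inv]
  rw [h5] at h4
  simp only [Matrix.nonsing_inv_eq_ringInverse] at h4 ⊢
  refine HasDerivAt.congr_deriv h4 ?_
  simp [L]
  rfl

end aux

theorem det_deriv {P : ℕ} (A B : Matrix (Fin P) (Fin P) ℝ) (v : ℝ)
    (h : IsUnit (A + v • B)) :
    HasDerivAt (fun w : ℝ => (A + w • B).det)
      ((A + v • B).det * ((A + v • B)⁻¹ * B).trace) v := by
  have hd := (Matrix.isUnit_iff_isUnit_det _).1 h
  have key : ∀ w : ℝ, A + w • B = (A + v • B) * (1 + (w - v) • ((A + v • B)⁻¹ * B)) := by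
    intro w
    rw [mul_add, mul_one, mul_smul_comm, Matrix.mul_nonsing_inv_cancel_left _ _ hd, sub_smul]
    abel
  have e : (fun w : ℝ => (A + w • B).det) = fun w : ℝ => (A + v • B).det *
      (1 + ((A + v • B)⁻¹ * B).trace * (w - v) + (det (1 + (Polynomial.X : Polynomial ℝ) •
        ((A + v • B)⁻¹ * B).map Polynomial.C)).divX.divX.eval (w - v) * (w - v) ^ 2) := by
    funext w
    rw [← Matrix.det_one_add_smul, ← Matrix.det_mul, ← key]
  rw [e]
  generalize (det (1 + (Polynomial.X : Polynomial ℝ) •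
        ((A + v • B)⁻¹ * B).map Polynomial.C)).divX.divX = p
  have hs : HasDerivAt (fun w : ℝ => w - v) 1 v := (hasDerivAt_id v).sub_const v
  have hp : HasDerivAt (fun w : ℝ => p.eval (w - v)) _ v :=
    HasDerivAt.comp (h₂ := fun x => p.eval x) (h := fun w : ℝ => w - v) v (p.hasDerivAt (v - v)) hs
  have := (((hs.const_mul ((A + v • B)⁻¹ * B).trace).const_add 1).add
    (hp.mul (hs.pow 2))).const_mul (A + v • B).det
  refine this.congr_deriv ?_
  simp

theorem quad_eq {P : ℕ} (M Δ : Matrix (Fin P) (Fin P) ℝ) (hΔ : Δ.IsSymm) :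
    ∑ a : Fin P × Fin P, ∑ b : Fin P × Fin P, vecOf Δ a * ((Mᵀ ⊗ₖ M) a b * vecOf Δ b)
      = (M * Δ * M * Δ).trace := by
  have h1 : vec Δ ⬝ᵥ ((Mᵀ ⊗ₖ M) *ᵥ vec Δ) = (M * Δ * M * Δ).trace := by
    rw [Matrix.kronecker_mulVec_vec, Matrix.vec_dotProduct_vec, hΔ.eq, Matrix.transpose_transpose,
      Matrix.trace_mul_comm]
  rw [← h1]
  simp only [dotProduct, mulVec, Finset.mul_sum]
  rfl

theorem stmt4 {P : ℕ} (hP : 0 < P) (Θ₀ Δ : Matrix (Fin P) (Fin P) ℝ)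
    (hΘ₀sym : Θ₀.IsSymm) (hΔsym : Δ.IsSymm)
    (hΘ₀ : Θ₀.PosDef) (hΘΔ : (Θ₀ + Δ).PosDef) :
    Real.log ((Θ₀ + Δ).det) =
      Real.log Θ₀.det + (Θ₀⁻¹ * Δ).trace -
        vecOf Δ ⬝ᵥ
          ((fun a b : Fin P × Fin P =>
              ∫ v in (0:ℝ)..1, (1 - v) *
                ((((Θ₀ + v • Δ)⁻¹)ᵀ ⊗ₖ (Θ₀ + v • Δ)⁻¹) a b)) *ᵥ
            vecOf Δ) := by
  have hpd : ∀ v ∈ Set.uIcc (0:ℝ) 1, (Θ₀ + v • Δ).PosDef := by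
    intro v hv
    rw [Set.uIcc_of_le zero_le_one] at hv
    have e : Θ₀ + v • Δ = (1 - v) • Θ₀ + v • (Θ₀ + Δ) := by
      rw [sub_smul, smul_add, one_smul]; abel
    rcases hv.1.eq_or_lt with h0 | h0
    · subst h0; simpa using hΘ₀
    · rw [e]
      exact Matrix.PosDef.posSemidef_add (hΘ₀.posSemidef.smul (sub_nonneg.2 hv.2)) (hΘΔ.smul h0)
  have hent : ∀ v ∈ Set.uIcc (0:ℝ) 1, ∀ i j,
      HasDerivAt (fun w : ℝ => (Θ₀ + w • Δ)⁻¹ i j)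
        (-((Θ₀ + v • Δ)⁻¹ * Δ * (Θ₀ + v • Δ)⁻¹) i j) v :=
    fun v hv i j => inv_entry_deriv Θ₀ Δ v (hpd v hv).isUnit i j
  have hcont : ∀ i j, ContinuousOn (fun w : ℝ => (Θ₀ + w • Δ)⁻¹ i j) (Set.uIcc (0:ℝ) 1) :=
    fun i j v hv => (hent v hv i j).continuousAt.continuousWithinAt
  have hint : ∀ a b : Fin P × Fin P, IntervalIntegrable (fun v : ℝ => vecOf Δ a * ((1 - v) *
      ((((Θ₀ + v • Δ)⁻¹)ᵀ ⊗ₖ (Θ₀ + v • Δ)⁻¹) a b) * vecOf Δ b)) MeasureTheory.volume 0 1 := by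
    intro a b
    apply ContinuousOn.intervalIntegrable
    simp only [Matrix.kroneckerMap_apply, Matrix.transpose_apply]
    exact continuousOn_const.mul (((continuousOn_const.sub continuousOn_id).mul
      ((hcont _ _).mul (hcont _ _))).mul continuousOn_const)
  have hint1 : ∀ a : Fin P × Fin P, IntervalIntegrable (fun v : ℝ => ∑ b : Fin P × Fin P,
      vecOf Δ a * ((1 - v) * ((((Θ₀ + v • Δ)⁻¹)ᵀ ⊗ₖ (Θ₀ + v • Δ)⁻¹) a b) * vecOf Δ b))
      MeasureTheory.volume 0 1 := by
    intro a
    have := IntervalIntegrable.sum Finset.univ (fun b _ => hint a b)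
    rw [Finset.sum_fn] at this
    exact this
  have hquad : vecOf Δ ⬝ᵥ
          ((fun a b : Fin P × Fin P =>
              ∫ v in (0:ℝ)..1, (1 - v) *
                ((((Θ₀ + v • Δ)⁻¹)ᵀ ⊗ₖ (Θ₀ + v • Δ)⁻¹) a b)) *ᵥ
            vecOf Δ) = ∫ v in (0:ℝ)..1, ∑ a : Fin P × Fin P, ∑ b : Fin P × Fin P,
              vecOf Δ a * ((1 - v) *
      ((((Θ₀ + v • Δ)⁻¹)ᵀ ⊗ₖ (Θ₀ + v • Δ)⁻¹) a b) * vecOf Δ b) := by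
    rw [intervalIntegral.integral_finsetSum
      (fun a _ => hint1 a)]
    simp only [dotProduct, mulVec, Finset.mul_sum]
    refine Finset.sum_congr rfl fun a _ => ?_
    rw [intervalIntegral.integral_finsetSum (fun b _ => hint a b)]
    refine Finset.sum_congr rfl fun b _ => ?_
    rw [intervalIntegral.integral_const_mul, intervalIntegral.integral_mul_const]
  have hsum : ∀ v : ℝ, ∑ a : Fin P × Fin P, ∑ b : Fin P × Fin P,
              vecOf Δ a * ((1 - v) *
      ((((Θ₀ + v • Δ)⁻¹)ᵀ ⊗ₖ (Θ₀ + v • Δ)⁻¹) a b) * vecOf Δ b)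
      = (1 - v) * ((Θ₀ + v • Δ)⁻¹ * Δ * (Θ₀ + v • Δ)⁻¹ * Δ).trace := by
    intro v
    rw [← quad_eq _ _ hΔsym]
    simp only [Finset.mul_sum]
    refine Finset.sum_congr rfl fun a _ => Finset.sum_congr rfl fun b _ => by ring
  have hderiv : ∀ v ∈ Set.uIcc (0:ℝ) 1, HasDerivAt (fun w : ℝ =>
      -(Real.log (Θ₀ + w • Δ).det + (1 - w) * ((Θ₀ + w • Δ)⁻¹ * Δ).trace))
      (∑ a : Fin P × Fin P, ∑ b : Fin P × Fin P,
              vecOf Δ a * ((1 - v) *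
      ((((Θ₀ + v • Δ)⁻¹)ᵀ ⊗ₖ (Θ₀ + v • Δ)⁻¹) a b) * vecOf Δ b)) v := by
    intro v hv
    have hne : (Θ₀ + v • Δ).det ≠ 0 := (hpd v hv).det_pos.ne'
    have h1 := (det_deriv Θ₀ Δ v (hpd v hv).isUnit).log hne
    have h2 : HasDerivAt (fun w : ℝ => ((Θ₀ + w • Δ)⁻¹ * Δ).trace)
        (-((Θ₀ + v • Δ)⁻¹ * Δ * (Θ₀ + v • Δ)⁻¹ * Δ).trace) v := by
      have : HasDerivAt (fun w : ℝ => ∑ i, ∑ j, (Θ₀ + w • Δ)⁻¹ i j * Δ j i)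
          (∑ i, ∑ j, (-((Θ₀ + v • Δ)⁻¹ * Δ * (Θ₀ + v • Δ)⁻¹) i j) * Δ j i) v :=
        HasDerivAt.fun_sum fun i _ => HasDerivAt.fun_sum fun j _ => (hent v hv i j).mul_const _
      have ht : ∀ N : Matrix (Fin P) (Fin P) ℝ, (N * Δ).trace = ∑ i, ∑ j, N i j * Δ j i := by
        intro N
        rfl
      simp only [ht]
      refine this.congr_deriv ?_
      simp only [neg_mul, Finset.sum_neg_distrib]
    have h3 := (h1.add (((hasDerivAt_id v).const_sub 1).mul h2)).neg
    refine h3.congr_deriv ?_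
    rw [hsum, mul_div_cancel_left₀ _ hne]
    simp only [id]
    ring
  have hfin := intervalIntegral.integral_eq_sub_of_hasDerivAt hderiv (by
    have := IntervalIntegrable.sum Finset.univ (fun a _ => hint1 a)
    rw [Finset.sum_fn] at this
    exact this)
  rw [hquad, hfin]
  simp
  ring
end

section
/- Let Θ₀ be a real symmetric positive definite P×P matrix whose eigenvalues all lie in (0, φ_max], and let Δ be a real symmetric P×P matrix such that Θ₀ + Δ is positive definite. Set η = ‖Δ‖₂ (the spectral norm of Δ). Then log det(Θ₀ + Δ) ≤ log det(Θ₀) + tr(Θ₀⁻¹ Δ) − (1/2) · (φ_max + η)^{−2} · ‖Δ‖_F². Equivalently, tr(Θ₀⁻¹ Δ) − [log det(Θ₀ + Δ) − log det(Θ₀)] ≥ (1/2) · (φ_max + η)^{−2} · ‖Δ‖_F². -/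
open Matrix

/-- The spectral norm of a square real matrix: the operator norm of the induced
linear map on Euclidean space. -/
noncomputable def specNorm {P : ℕ} (A : Matrix (Fin P) (Fin P) ℝ) : ℝ :=
  ‖Matrix.toEuclideanCLM (𝕜 := ℝ) A‖

theorem aux_log1 (t : ℝ) (h0 : 0 < t) (h1 : t ≤ 1) :
    (t - 1) ^ 2 / 2 ≤ t - 1 - Real.log t := by
  have hanti : AntitoneOn (fun x : ℝ => x - 1 - Real.log x - (x - 1) ^ 2 / 2) (Set.Ioc 0 1) := by
    have hd : ∀ x : ℝ, 0 < x → HasDerivAt (fun x : ℝ => x - 1 - Real.log x - (x - 1) ^ 2 / 2)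
        (1 - x⁻¹ - (x - 1)) x := by
      intro x hx
      have h := (((hasDerivAt_id x).sub_const 1).sub (Real.hasDerivAt_log hx.ne')).sub
        ((((hasDerivAt_id x).sub_const 1).pow 2).div_const 2)
      refine h.congr_deriv ?_
      simp; try ring
    refine antitoneOn_of_deriv_nonpos (convex_Ioc 0 1)
      (fun x hx => (hd x hx.1).continuousAt.continuousWithinAt) ?_ ?_
    · intro x hx
      rw [interior_Ioc] at hx
      exact (hd x hx.1).differentiableAt.differentiableWithinAt
    · intro x hx
      rw [interior_Ioc] at hx
      rw [(hd x hx.1).deriv]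
      have hx0 := hx.1
      have : 1 - x⁻¹ - (x - 1) = -((x - 1) ^ 2 / x) := by field_simp; ring
      rw [this]
      have : 0 ≤ (x - 1) ^ 2 / x := by positivity
      linarith
  have := hanti ⟨h0, h1⟩ ⟨one_pos, le_refl _⟩ h1
  simp at this
  linarith

theorem aux_log2 (t : ℝ) (h1 : 1 ≤ t) :
    (1 - t⁻¹) ^ 2 / 2 ≤ t - 1 - Real.log t := by
  have hmono : MonotoneOn (fun x : ℝ => x - 1 - Real.log x - (1 - x⁻¹) ^ 2 / 2) (Set.Ici 1) := by
    have hd : ∀ x : ℝ, 0 < x → HasDerivAt (fun x : ℝ => x - 1 - Real.log x - (1 - x⁻¹) ^ 2 / 2)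
        (1 - x⁻¹ - (1 - x⁻¹) * (x ^ 2)⁻¹) x := by
      intro x hx
      have h := (((hasDerivAt_id x).sub_const 1).sub (Real.hasDerivAt_log hx.ne')).sub
        ((((hasDerivAt_inv hx.ne').const_sub 1).pow 2).div_const 2)
      refine h.congr_deriv ?_
      simp; try ring
    refine monotoneOn_of_deriv_nonneg (convex_Ici 1)
      (fun x hx => (hd x (lt_of_lt_of_le one_pos hx)).continuousAt.continuousWithinAt) ?_ ?_
    · intro x hx
      rw [interior_Ici] at hx
      exact (hd x (lt_trans one_pos hx)).differentiableAt.differentiableWithinAt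
    · intro x hx
      rw [interior_Ici] at hx
      rw [(hd x (lt_trans one_pos hx)).deriv]
      have hx1 : 1 < x := hx
      have a1 : x⁻¹ ≤ 1 := inv_le_one_of_one_le₀ hx1.le
      have a2 : (x ^ 2)⁻¹ ≤ 1 := inv_le_one_of_one_le₀ (by nlinarith)
      nlinarith [mul_nonneg (sub_nonneg.2 a1) (sub_nonneg.2 a2)]
  have := hmono (Set.mem_Ici.2 (le_refl (1 : ℝ))) (Set.mem_Ici.2 h1) h1
  simp at this
  linarith

theorem aux_scalar (a b M : ℝ) (ha : 0 < a) (hb : 0 < b) (haM : a ≤ M) (hbM : b ≤ M) :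
    (1 / 2) * (M ^ 2)⁻¹ * (a ^ 2 - 2 * (a * b) + b ^ 2) ≤
      a⁻¹ * b - 1 - Real.log b + Real.log a := by
  have hM : 0 < M := lt_of_lt_of_le ha haM
  have hlog : Real.log (b / a) = Real.log b - Real.log a := Real.log_div hb.ne' ha.ne'
  rcases le_total b a with h | h
  · have h1 := aux_log1 (b / a) (by positivity) ((div_le_one ha).2 h)
    have h2 : (M ^ 2)⁻¹ ≤ (a ^ 2)⁻¹ := by gcongr
    have h3 : (b / a - 1) ^ 2 / 2 = (1 / 2) * (a ^ 2)⁻¹ * (b - a) ^ 2 := by field_simp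
    have h4 : (M ^ 2)⁻¹ * (b - a) ^ 2 ≤ (a ^ 2)⁻¹ * (b - a) ^ 2 := by gcongr
    have h5 : b / a = a⁻¹ * b := by field_simp
    rw [h3, hlog] at h1
    rw [h5] at h1
    nlinarith
  · have h1 := aux_log2 (b / a) ((one_le_div ha).2 h)
    have h2 : (M ^ 2)⁻¹ ≤ (b ^ 2)⁻¹ := by gcongr
    have h3 : (1 - (b / a)⁻¹) ^ 2 / 2 = (1 / 2) * (b ^ 2)⁻¹ * (b - a) ^ 2 := by field_simp
    have h4 : (M ^ 2)⁻¹ * (b - a) ^ 2 ≤ (b ^ 2)⁻¹ * (b - a) ^ 2 := by gcongr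
    have h5 : b / a = a⁻¹ * b := by field_simp
    rw [h3, hlog] at h1
    rw [h5] at h1
    nlinarith

theorem aux_spec {P : ℕ} (A : Matrix (Fin P) (Fin P) ℝ) (hA : A.PosDef) :
    ∃ (U : Matrix (Fin P) (Fin P) ℝ) (a : Fin P → ℝ), Uᵀ * U = 1 ∧ U * Uᵀ = 1 ∧
      A = U * diagonal a * Uᵀ ∧ (∀ i, 0 < a i) := by
  refine ⟨hA.1.eigenvectorUnitary, hA.1.eigenvalues, ?_, ?_, ?_, hA.eigenvalues_pos⟩
  · have := Unitary.coe_star_mul_self hA.1.eigenvectorUnitary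
    simpa [star_eq_conjTranspose] using this
  · have := Unitary.coe_mul_star_self hA.1.eigenvectorUnitary
    simpa [star_eq_conjTranspose] using this
  · have := hA.1.spectral_theorem
    simpa [star_eq_conjTranspose, Unitary.conjStarAlgAut_apply, Function.comp_def] using this

theorem aux_trace {P : ℕ} (U V : Matrix (Fin P) (Fin P) ℝ) (f g : Fin P → ℝ) :
    ((U * diagonal f * Uᵀ) * (V * diagonal g * Vᵀ)).trace =
      ∑ i, ∑ j, ((Uᵀ * V) i j) ^ 2 * (f i * g j) := by
  have : ((U * diagonal f * Uᵀ) * (V * diagonal g * Vᵀ)).trace =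
      ((diagonal f * (Uᵀ * V)) * (diagonal g * (Uᵀ * V)ᵀ)).trace := by
    rw [transpose_mul, transpose_transpose]
    simp only [Matrix.mul_assoc]
    rw [Matrix.trace_mul_comm]
    simp only [Matrix.mul_assoc]
  rw [this, Matrix.trace]
  refine Finset.sum_congr rfl fun i _ => ?_
  rw [Matrix.diag_apply, Matrix.mul_apply]
  refine Finset.sum_congr rfl fun j _ => ?_
  rw [Matrix.diagonal_mul, Matrix.diagonal_mul, Matrix.transpose_apply]
  ring

theorem aux_sumcol {P : ℕ} (W : Matrix (Fin P) (Fin P) ℝ) (h : Wᵀ * W = 1) (j : Fin P) :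
    ∑ i, W i j ^ 2 = 1 := by
  have := congrFun (congrFun h j) j
  simpa [Matrix.mul_apply, sq] using this

theorem aux_quad {P : ℕ} (D V : Matrix (Fin P) (Fin P) ℝ) (h : Vᵀ * V = 1) (j : Fin P) :
    (Vᵀ * D * V) j j ≤ specNorm D := by
  set v : EuclideanSpace ℝ (Fin P) := WithLp.toLp 2 (fun i => V i j) with hv
  have hn : ‖v‖ = 1 := by
    rw [EuclideanSpace.norm_eq]
    simp [hv, aux_sumcol V h j]
  have h1 : (Vᵀ * D * V) j j = inner ℝ v (Matrix.toEuclideanCLM (𝕜 := ℝ) D v) := by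
    rw [Matrix.mul_assoc, Matrix.mul_apply]
    simp [hv, PiLp.inner_apply, Matrix.mulVec, dotProduct, Matrix.mul_apply, mul_comm]
  rw [h1]
  refine (real_inner_le_norm _ _).trans ?_
  rw [hn, one_mul]
  refine (ContinuousLinearMap.le_opNorm _ _).trans ?_
  rw [hn, mul_one, specNorm]

theorem aux_det {P : ℕ} (U : Matrix (Fin P) (Fin P) ℝ) (a : Fin P → ℝ) (h : U * Uᵀ = 1)
    (ha : ∀ i, 0 < a i) :
    Real.log (U * diagonal a * Uᵀ).det = ∑ i, Real.log (a i) := by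
  have h1 := congrArg Matrix.det h
  rw [Matrix.det_mul, Matrix.det_one] at h1
  rw [Matrix.det_mul, Matrix.det_mul, mul_right_comm, h1, one_mul, Matrix.det_diagonal,
    Real.log_prod (fun i _ => (ha i).ne')]

theorem stmt11 {P : ℕ} (hP : 0 < P) (Θ₀ Δ : Matrix (Fin P) (Fin P) ℝ)
    (hΘ₀ : Θ₀.PosDef) (φmax : ℝ)
    (heig : ∀ (c : ℝ) (x : Fin P → ℝ), x ≠ 0 → Θ₀ *ᵥ x = c • x →
      0 < c ∧ c ≤ φmax)
    (hΔ : Δ.IsSymm) (hpd : (Θ₀ + Δ).PosDef)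
    (η : ℝ) (hη : η = specNorm Δ) :
    Real.log ((Θ₀ + Δ).det) ≤
      Real.log Θ₀.det + (Θ₀⁻¹ * Δ).trace -
        (1 / 2) * ((φmax + η) ^ 2)⁻¹ * ∑ p, ∑ q, (Δ p q) ^ 2 := by
  obtain ⟨U, a, hU1, hU2, hA, ha⟩ := aux_spec Θ₀ hΘ₀
  obtain ⟨V, b, hV1, hV2, hB, hb⟩ := aux_spec (Θ₀ + Δ) hpd
  have hη0 : 0 ≤ η := by rw [hη, specNorm]; exact norm_nonneg _
  have haφ : ∀ i, a i ≤ φmax := by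
    intro i
    refine (heig (a i) (fun k => U k i) ?_ ?_).2
    · intro h0
      have h1 := aux_sumcol U hU1 i
      have h2 : ∀ k, U k i = 0 := fun k => congrFun h0 k
      simp [h2] at h1
    · have h1 : Θ₀ * U = U * diagonal a := by
        rw [hA, Matrix.mul_assoc, hU1, Matrix.mul_one]
      ext k
      have h2 := congrFun (congrFun h1 k) i
      rw [Matrix.mul_diagonal, Matrix.mul_apply] at h2
      simp only [Matrix.mulVec, dotProduct, Pi.smul_apply, smul_eq_mul]
      rw [h2, mul_comm]
  set W := Uᵀ * V with hW
  have hW1 : Wᵀ * W = 1 := by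
    rw [hW, transpose_mul, transpose_transpose, Matrix.mul_assoc, ← Matrix.mul_assoc U, hU2,
      Matrix.one_mul, hV1]
  have hW2 : W * Wᵀ = 1 := mul_eq_one_comm.1 hW1
  have hcol : ∀ j, ∑ i, W i j ^ 2 = 1 := aux_sumcol W hW1
  have hrow : ∀ i, ∑ j, W i j ^ 2 = 1 := aux_sumcol Wᵀ (by simpa using hW2)
  have hbφ : ∀ j, b j ≤ φmax + η := by
    intro j
    have h1 : Vᵀ * (Θ₀ + Δ) * V = diagonal b := by
      rw [hB, Matrix.mul_assoc, Matrix.mul_assoc, hV1, Matrix.mul_one, ← Matrix.mul_assoc, hV1,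
        Matrix.one_mul]
    have h2 : Vᵀ * Θ₀ * V = Wᵀ * (diagonal a * W) := by
      rw [hW, hA, transpose_mul, transpose_transpose]
      simp only [Matrix.mul_assoc]
    have h3 : (Vᵀ * Θ₀ * V) j j ≤ φmax := by
      rw [h2, Matrix.mul_apply]
      calc _ = ∑ i, a i * W i j ^ 2 := by
            refine Finset.sum_congr rfl fun i _ => ?_
            rw [Matrix.diagonal_mul, transpose_apply]; ring
        _ ≤ ∑ i, φmax * W i j ^ 2 :=
            Finset.sum_le_sum fun i _ => mul_le_mul_of_nonneg_right (haφ i) (sq_nonneg _)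
        _ = φmax := by rw [← Finset.mul_sum, hcol, mul_one]
    have h4 := aux_quad Δ V hV1 j
    have h5 := congrFun (congrFun h1 j) j
    rw [Matrix.mul_add, Matrix.add_mul, Matrix.add_apply, diagonal_apply_eq] at h5
    linarith
  have hinv : Θ₀⁻¹ = U * diagonal (fun i => (a i)⁻¹) * Uᵀ := by
    apply Matrix.inv_eq_right_inv
    have h1 : diagonal a * diagonal (fun i => (a i)⁻¹) = (1 : Matrix (Fin P) (Fin P) ℝ) := by
      rw [diagonal_mul_diagonal, ← diagonal_one]
      congr 1; ext i; exact mul_inv_cancel₀ (ha i).ne'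
    calc Θ₀ * (U * diagonal (fun i => (a i)⁻¹) * Uᵀ)
        = U * (diagonal a * ((Uᵀ * U) * diagonal (fun i => (a i)⁻¹))) * Uᵀ := by
          rw [hA]; simp only [Matrix.mul_assoc]
      _ = 1 := by rw [hU1, Matrix.one_mul, h1, Matrix.mul_one, hU2]
  have hdet1 : Real.log Θ₀.det = ∑ i, Real.log (a i) := by rw [hA]; exact aux_det U a hU2 ha
  have hdet2 : Real.log (Θ₀ + Δ).det = ∑ i, Real.log (b i) := by rw [hB]; exact aux_det V b hV2 hb
  have hrowf : ∀ f : Fin P → ℝ, ∑ i, f i = ∑ i, ∑ j, W i j ^ 2 * f i := by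
    intro f
    refine Finset.sum_congr rfl fun i _ => ?_
    rw [← Finset.sum_mul, hrow, one_mul]
  have hcolf : ∀ f : Fin P → ℝ, ∑ j, f j = ∑ i, ∑ j, W i j ^ 2 * f j := by
    intro f
    rw [Finset.sum_comm]
    refine Finset.sum_congr rfl fun i _ => ?_
    rw [← Finset.sum_mul, hcol, one_mul]
  have hdiag : ∀ (X : Matrix (Fin P) (Fin P) ℝ) (f : Fin P → ℝ), Xᵀ * X = 1 →
      ((X * diagonal f * Xᵀ) * (X * diagonal f * Xᵀ)).trace = ∑ i, f i ^ 2 := by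
    intro X f hX
    rw [aux_trace, hX]
    simp [Matrix.one_apply, sq]
  have hAA : (Θ₀ * Θ₀).trace = ∑ i, a i ^ 2 := by
    have := hdiag U a hU1
    rwa [← hA] at this
  have hBB : ((Θ₀ + Δ) * (Θ₀ + Δ)).trace = ∑ i, b i ^ 2 := by
    have := hdiag V b hV1
    rwa [← hB] at this
  have hAB : (Θ₀ * (Θ₀ + Δ)).trace = ∑ i, ∑ j, W i j ^ 2 * (a i * b j) := by
    have := aux_trace U V a b
    rwa [← hB, ← hA] at this
  have hIB : (Θ₀⁻¹ * (Θ₀ + Δ)).trace = ∑ i, ∑ j, W i j ^ 2 * ((a i)⁻¹ * b j) := by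
    have := aux_trace U V (fun i => (a i)⁻¹) b
    rwa [← hB, ← hinv] at this
  have hIA : (Θ₀⁻¹ * Θ₀).trace = ∑ _i : Fin P, (1 : ℝ) := by
    rw [Matrix.nonsing_inv_mul _ ((Matrix.isUnit_iff_isUnit_det _).1 hΘ₀.isUnit), Matrix.trace_one]
    simp
  have hF : ∑ p, ∑ q, (Δ p q) ^ 2 = (Δ * Δ).trace := by
    rw [Matrix.trace]
    refine Finset.sum_congr rfl fun p _ => ?_
    rw [Matrix.diag_apply, Matrix.mul_apply]
    refine Finset.sum_congr rfl fun q _ => ?_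
    rw [hΔ.apply p q, sq]
  have hF2 : (Δ * Δ).trace = (Θ₀ * Θ₀).trace - 2 * (Θ₀ * (Θ₀ + Δ)).trace
      + ((Θ₀ + Δ) * (Θ₀ + Δ)).trace := by
    simp only [Matrix.mul_add, Matrix.add_mul, Matrix.trace_add]
    rw [Matrix.trace_mul_comm Δ Θ₀]
    ring
  have hI : (Θ₀⁻¹ * Δ).trace = (Θ₀⁻¹ * (Θ₀ + Δ)).trace - (Θ₀⁻¹ * Θ₀).trace := by
    rw [Matrix.mul_add, Matrix.trace_add]; ring
  have key : ∑ i, ∑ j, W i j ^ 2 *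
        ((1 / 2) * ((φmax + η) ^ 2)⁻¹ * (a i ^ 2 - 2 * (a i * b j) + b j ^ 2)) ≤
      ∑ i, ∑ j, W i j ^ 2 * ((a i)⁻¹ * b j - 1 - Real.log (b j) + Real.log (a i)) := by
    refine Finset.sum_le_sum fun i _ => Finset.sum_le_sum fun j _ => ?_
    refine mul_le_mul_of_nonneg_left ?_ (sq_nonneg _)
    exact aux_scalar _ _ _ (ha i) (hb j) (by linarith [haφ i]) (hbφ j)
  have hl : ∑ i, ∑ j, W i j ^ 2 *
        ((1 / 2) * ((φmax + η) ^ 2)⁻¹ * (a i ^ 2 - 2 * (a i * b j) + b j ^ 2)) =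
      (1 / 2) * ((φmax + η) ^ 2)⁻¹ * ∑ p, ∑ q, (Δ p q) ^ 2 := by
    rw [hF, hF2, hAA, hBB, hAB, hrowf (fun i => a i ^ 2), hcolf (fun i => b i ^ 2)]
    simp only [Finset.mul_sum, ← Finset.sum_sub_distrib, ← Finset.sum_add_distrib]
    refine Finset.sum_congr rfl fun i _ => Finset.sum_congr rfl fun j _ => ?_
    ring
  have hr : ∑ i, ∑ j, W i j ^ 2 * ((a i)⁻¹ * b j - 1 - Real.log (b j) + Real.log (a i)) =
      (Θ₀⁻¹ * Δ).trace - Real.log (Θ₀ + Δ).det + Real.log Θ₀.det := by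
    rw [hI, hdet1, hdet2, hIB, hIA, hrowf (fun _ => 1), hrowf (fun i => Real.log (a i)),
      hcolf (fun i => Real.log (b i))]
    simp only [← Finset.sum_sub_distrib, ← Finset.sum_add_distrib]
    refine Finset.sum_congr rfl fun i _ => Finset.sum_congr rfl fun j _ => ?_
    ring
  rw [hl, hr] at key
  linarith
end

section
/- Let E be a real normed vector space, let G : E → ℝ be a convex function with G(0) = 0, and let r > 0. If G(x) > 0 for every x ∈ E with ‖x‖ = r, then every x ∈ E with G(x) ≤ 0 satisfies ‖x‖ < r. In particular, any minimizer x̂ of G (which satisfies G(x̂) ≤ G(0) = 0) lies in the open ball of radius r around the origin. -/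
theorem stmt14 {E : Type*} [NormedAddCommGroup E] [NormedSpace ℝ E]
    (G : E → ℝ) (hG : ConvexOn ℝ Set.univ G) (hG0 : G 0 = 0)
    (r : ℝ) (hr : 0 < r)
    (hpos : ∀ x : E, ‖x‖ = r → 0 < G x) :
    ∀ x : E, G x ≤ 0 → ‖x‖ < r := by
  intro x hx
  by_contra hlt
  have hle : r ≤ ‖x‖ := not_lt.mp hlt
  have hxpos : 0 < ‖x‖ := lt_of_lt_of_le hr hle
  have ht0 : 0 ≤ r / ‖x‖ := by positivity
  have ht1 : r / ‖x‖ ≤ 1 := (div_le_one hxpos).mpr hle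
  have hnorm : ‖(r / ‖x‖) • x‖ = r := by
    rw [norm_smul, Real.norm_of_nonneg ht0, div_mul_cancel₀ _ hxpos.ne']
  have h1 := hpos _ hnorm
  have h2 := hG.2 (Set.mem_univ x) (Set.mem_univ (0 : E)) ht0 (sub_nonneg.mpr ht1)
    (by ring)
  simp only [smul_zero, add_zero, hG0, smul_eq_mul, mul_zero] at h2
  have h3 := mul_nonpos_of_nonneg_of_nonpos ht0 hx
  linarith
end
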